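/- Let α ≥ 3 be an integer and let G be a graph on n vertices whose independence number equals α. Then G contains a strong odd (2α−1)-immersion of a complete graph on at least ⌊n/(2.25·α − f(α))⌋ − 1 vertices, where f(3) = f(4) = 2.25 and f(α) = 2.25 + Σ_{i=6}^{α+1} 1/(2i) for α ≥ 5. -/

import Mathlib

/-- `G` contains a strong odd `m`-immersion of a complete graph on `k` vertices:
there are `k` distinct branch vertices `φ u`, and for every pair `u < v` (i.e. every
edge of `K_k`) a path `P u v` joining `φ u` and `φ v`, the paths being pairwise
edge-disjoint, each of odd length, each of length at most `m`, and with no branch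
vertex appearing as an interior vertex of any of the paths. -/
def StrongOddBoundedCliqueImmersion {V : Type*} (G : SimpleGraph V) (k m : ℕ) : Prop :=
  ∃ (φ : Fin k → V) (P : ∀ u v : Fin k, G.Walk (φ u) (φ v)),
    Function.Injective φ ∧
    (∀ u v : Fin k, u < v → (P u v).IsPath) ∧
    (∀ u v u' v' : Fin k, u < v → u' < v' → (u, v) ≠ (u', v') →
      ∀ e ∈ (P u v).edges, e ∉ (P u' v').edges) ∧
    (∀ u v : Fin k, u < v → Odd (P u v).length) ∧
    (∀ u v : Fin k, u < v → (P u v).length ≤ m) ∧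
    (∀ u v w : Fin k, u < v → φ w ∈ (P u v).support → φ w = φ u ∨ φ w = φ v)

/-- The independence number of `G` equals `a`. -/
def IndepNumEq {V : Type*} (G : SimpleGraph V) (a : ℕ) : Prop :=
  (∃ I : Finset V, (I : Set V).Pairwise (fun x y => ¬ G.Adj x y) ∧ I.card = a) ∧
  ∀ I : Finset V, (I : Set V).Pairwise (fun x y => ¬ G.Adj x y) → I.card ≤ a

/-- The function `f` of the main theorem: `f 3 = f 4 = 2.25` and
`f α = 2.25 + ∑_{i=6}^{α+1} 1/(2i)` for `α ≥ 5`. -/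
def fMain (a : ℕ) : ℚ :=
  if a ≤ 4 then 9 / 4
  else 9 / 4 + ∑ i ∈ Finset.Icc 6 (a + 1), 1 / (2 * (i : ℚ))

open Finset Classical in
theorem cut_link {V : Type*} (s : V) (B : V → Finset V) (M : Finset V) (N : ℕ) :
    ∀ (U : Finset V) (A : V → Finset V), U.card = N →
    (∀ X : Finset V, s ∉ X → (M.filter (fun m => A m ⊆ X)).card ≤
      (U.filter (fun u => (∃ i ∈ B u, i ∈ X) ∧ ∃ i ∈ B u, i ∉ X)).card) →
    ∃ own : V → V, ∀ m ∈ M, ∀ X : Finset V, s ∉ X → A m ⊆ X →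
      ∃ u ∈ U, own u = m ∧ (∃ i ∈ B u, i ∈ X) ∧ ∃ i ∈ B u, i ∉ X := by
  induction N with
  | zero =>
    intro U A hU h
    have hU' : U = ∅ := Finset.card_eq_zero.mp hU
    subst hU'
    refine ⟨id, fun m hm X hs hX => ?_⟩
    have := h X hs
    simp at this
    exact absurd hX (this hm)
  | succ N ih =>
    intro U A hU h
    by_cases hall : ∀ m ∈ M, s ∈ A m
    · exact ⟨id, fun m hm X hs hX => absurd (hX (hall m hm)) hs⟩
    push Not at hall
    obtain ⟨m0, hm0, hs0⟩ := hall
    set c : Finset V → ℕ := fun X => (U.filter (fun u => (∃ i ∈ B u, i ∈ X) ∧ ∃ i ∈ B u, i ∉ X)).card with hc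
    set q : Finset V → ℕ := fun X => (M.filter (fun m => A m ⊆ X)).card with hq
    have h' : ∀ X, s ∉ X → q X ≤ c X := h
    have key : ∃ m ∈ M, s ∉ A m ∧ ∀ u ∈ U, (∃ i ∈ B u, i ∈ A m) → ∀ Y : Finset V, s ∉ Y → q Y = c Y →
        (∃ i ∈ B u, i ∈ Y) → (∃ i ∈ B u, i ∉ Y) → A m ⊆ Y := by
      by_cases hex : ∃ X : Finset V, s ∉ X ∧ q X = c X ∧ 1 ≤ q X
      · obtain ⟨X, hX⟩ := exists_minimal_of_wellFoundedLT (fun X : Finset V => s ∉ X ∧ q X = c X ∧ 1 ≤ q X) hex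
        obtain ⟨⟨hsX, htX, hX1⟩, hmin⟩ := hX
        obtain ⟨m, hm⟩ := Finset.card_pos.mp hX1
        rw [Finset.mem_filter] at hm
        refine ⟨m, hm.1, fun hh => hsX (hm.2 hh), ?_⟩
        intro u hu hum Y hsY htY huY1 huY2
        by_contra hmY
        have hsI : s ∉ X ∩ Y := fun hh => hsX (Finset.mem_inter.mp hh).1
        have hsU : s ∉ X ∪ Y := fun hh => (Finset.mem_union.mp hh).elim hsX hsY
        have e1 : q X + q Y ≤ q (X ∩ Y) + q (X ∪ Y) := by
          simp only [hq, Finset.card_filter, ← Finset.sum_add_distrib]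
          apply Finset.sum_le_sum
          intro x _
          have a1 : A x ⊆ X → A x ⊆ X ∪ Y := fun hh => hh.trans Finset.subset_union_left
          have a2 : A x ⊆ Y → A x ⊆ X ∪ Y := fun hh => hh.trans Finset.subset_union_right
          have a3 : A x ⊆ X → A x ⊆ Y → A x ⊆ X ∩ Y := fun hh h2 => Finset.subset_inter hh h2
          split_ifs <;> first | omega | tauto
        have pt : ∀ x, (if (∃ i ∈ B x, i ∈ X ∩ Y) ∧ ∃ i ∈ B x, i ∉ X ∩ Y then 1 else 0) +
            (if (∃ i ∈ B x, i ∈ X ∪ Y) ∧ ∃ i ∈ B x, i ∉ X ∪ Y then 1 else 0) ≤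
            (if (∃ i ∈ B x, i ∈ X) ∧ ∃ i ∈ B x, i ∉ X then 1 else 0) +
            (if (∃ i ∈ B x, i ∈ Y) ∧ ∃ i ∈ B x, i ∉ Y then 1 else 0) := by
          intro x
          split_ifs <;> first | omega | (simp only [Finset.mem_inter, Finset.mem_union] at *; grind)
        have e2 : c (X ∩ Y) + c (X ∪ Y) ≤ c X + c Y := by
          simp only [hc, Finset.card_filter, ← Finset.sum_add_distrib]
          exact Finset.sum_le_sum fun x _ => pt x
        have g1 := h' _ hsI
        have g2 := h' _ hsU
        have ht : q (X ∩ Y) = c (X ∩ Y) := by omega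
        have hz : q (X ∩ Y) = 0 := by
          by_contra hne
          have := hmin ⟨hsI, ht, by omega⟩ Finset.inter_subset_left
          exact hmY ((hm.2.trans this).trans Finset.inter_subset_right)
        have hcz : c (X ∩ Y) = 0 := by omega
        have hnc : ¬ ((∃ i ∈ B u, i ∈ X ∩ Y) ∧ ∃ i ∈ B u, i ∉ X ∩ Y) := by
          intro hh
          have := Finset.card_eq_zero.mp hcz
          have h2 : u ∈ U.filter (fun u => (∃ i ∈ B u, i ∈ X ∩ Y) ∧ ∃ i ∈ B u, i ∉ X ∩ Y) :=
            Finset.mem_filter.mpr ⟨hu, hh⟩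
          rw [this] at h2
          simp at h2
        have e3 : c (X ∩ Y) + c (X ∪ Y) < c X + c Y := by
          simp only [hc, Finset.card_filter, ← Finset.sum_add_distrib]
          apply Finset.sum_lt_sum (fun x _ => pt x)
          refine ⟨u, hu, ?_⟩
          obtain ⟨i, hi, him⟩ := hum
          have hiX := hm.2 him
          obtain ⟨j, hj, hjY⟩ := huY1
          obtain ⟨l, hl, hlY⟩ := huY2
          have hno : ∀ i ∈ B u, i ∉ X ∩ Y := by
            intro z hz hzz
            exact hnc ⟨⟨z, hz, hzz⟩, l, hl, fun hh => hlY (Finset.mem_inter.mp hh).2⟩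
          have hjX : j ∉ X := fun hh => hno j hj (Finset.mem_inter.mpr ⟨hh, hjY⟩)
          have p1 : (∃ i ∈ B u, i ∈ X) ∧ ∃ i ∈ B u, i ∉ X := ⟨⟨i, hi, hiX⟩, j, hj, hjX⟩
          have p2 : (∃ i ∈ B u, i ∈ Y) ∧ ∃ i ∈ B u, i ∉ Y := ⟨⟨j, hj, hjY⟩, l, hl, hlY⟩
          rw [if_neg hnc, if_pos p1, if_pos p2]
          split_ifs <;> omega
        omega
      · refine ⟨m0, hm0, hs0, ?_⟩
        intro u hu _ Y hsY htY h1 h2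
        exfalso
        apply hex
        refine ⟨Y, hsY, htY, ?_⟩
        rw [htY]
        exact Finset.card_pos.mpr ⟨u, Finset.mem_filter.mpr ⟨hu, h1, h2⟩⟩
    obtain ⟨m, hm, hsm, hkey⟩ := key
    have hpos : 1 ≤ c (A m) := by
      refine le_trans ?_ (h' _ hsm)
      exact Finset.card_pos.mpr ⟨m, Finset.mem_filter.mpr ⟨hm, Finset.Subset.refl _⟩⟩
    obtain ⟨u, hu⟩ := Finset.card_pos.mp hpos
    rw [Finset.mem_filter] at hu
    obtain ⟨huU, hu1, hu2⟩ := hu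
    obtain ⟨own, hown⟩ := ih (U.erase u) (Function.update A m (A m ∪ B u))
      (by rw [Finset.card_erase_of_mem huU]; omega) (by
        intro X hsX
        have hqle : (M.filter (fun x => Function.update A m (A m ∪ B u) x ⊆ X)) ⊆ M.filter (fun x => A x ⊆ X) := by
          intro x hx
          rw [Finset.mem_filter] at hx ⊢
          refine ⟨hx.1, ?_⟩
          by_cases hxm : x = m
          · subst hxm
            have := hx.2
            rw [Function.update_self] at this
            exact Finset.subset_union_left.trans this
          · have := hx.2
            rwa [Function.update_of_ne hxm] at this
        rw [Finset.filter_erase]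
        by_cases hcr : (∃ i ∈ B u, i ∈ X) ∧ ∃ i ∈ B u, i ∉ X
        · have hmem : u ∈ U.filter (fun u => (∃ i ∈ B u, i ∈ X) ∧ ∃ i ∈ B u, i ∉ X) :=
            Finset.mem_filter.mpr ⟨huU, hcr⟩
          rw [Finset.card_erase_of_mem hmem]
          by_cases ht : q X = c X
          · have hAX := hkey u huU hu1 X hsX ht hcr.1 hcr.2
            have hlt : (M.filter (fun x => Function.update A m (A m ∪ B u) x ⊆ X)).card < q X := by
              apply Finset.card_lt_card
              refine ⟨hqle, fun hh => ?_⟩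
              have := hh (Finset.mem_filter.mpr ⟨hm, hAX⟩)
              rw [Finset.mem_filter, Function.update_self] at this
              obtain ⟨l, hl, hlX⟩ := hcr.2
              exact hlX (this.2 (Finset.mem_union_right _ hl))
            have := h' X hsX
            change _ ≤ c X - 1
            omega
          · have := h' X hsX
            have h3 := Finset.card_le_card hqle
            change _ ≤ c X - 1
            change _ ≤ q X at h3
            omega
        · have hnm : u ∉ U.filter (fun u => (∃ i ∈ B u, i ∈ X) ∧ ∃ i ∈ B u, i ∉ X) :=
            fun hh => hcr (Finset.mem_filter.mp hh).2
          rw [Finset.erase_eq_of_notMem hnm]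
          exact (Finset.card_le_card hqle).trans (h' X hsX))
    refine ⟨Function.update own u m, fun x hx X hsX hAX => ?_⟩
    have conv : ∀ Z : Finset V, Z = Z → (∃ v ∈ U.erase u, own v = x ∧ (∃ i ∈ B v, i ∈ X) ∧ ∃ i ∈ B v, i ∉ X) →
        ∃ v ∈ U, Function.update own u m v = x ∧ (∃ i ∈ B v, i ∈ X) ∧ ∃ i ∈ B v, i ∉ X := by
      rintro _ _ ⟨v, hv, h1, h2⟩
      refine ⟨v, Finset.mem_of_mem_erase hv, ?_, h2⟩
      rw [Function.update_of_ne (Finset.ne_of_mem_erase hv)]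
      exact h1
    by_cases hxm : x = m
    · subst hxm
      by_cases hB : B u ⊆ X
      · apply conv ∅ rfl
        apply hown x hx X hsX
        rw [Function.update_self]
        exact Finset.union_subset hAX hB
      · obtain ⟨l, hl, hlX⟩ := Finset.not_subset.mp hB
        obtain ⟨i, hi, hiA⟩ := hu1
        exact ⟨u, huU, Function.update_self .., ⟨i, hi, hAX hiA⟩, l, hl, hlX⟩
    · apply conv ∅ rfl
      apply hown x hx X hsX
      rwa [Function.update_of_ne hxm]

/-- `x` and `y` are joined by an admissible path inside `W` using only edges satisfying `E`. -/
def Lk {V : Type*} (G : SimpleGraph V) (W M : Finset V) (L : ℕ) (E : Sym2 V → Prop) (x y : V) : Prop :=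
  ∃ p : G.Walk x y, p.IsPath ∧ Odd p.length ∧ p.length ≤ L ∧ (∀ e ∈ p.edges, E e) ∧
    (∀ z ∈ p.support, z ∈ W) ∧ (∀ z ∈ M, z ∈ p.support → z = x ∨ z = y)

/-- strong odd immersion with branch set `M` inside `W`. -/
def SI {V : Type*} (G : SimpleGraph V) (W M : Finset V) (L : ℕ) : Prop :=
  M ⊆ W ∧ ∃ κ : Sym2 V → Sym2 V, ∀ x ∈ M, ∀ y ∈ M, x ≠ y →
    Lk G W M L (fun e => κ e = s(x, y)) x y

theorem Lk.symm {V : Type*} {G : SimpleGraph V} {W M : Finset V} {L : ℕ} {E : Sym2 V → Prop} {x y : V}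
    (h : Lk G W M L E x y) : Lk G W M L E y x := by
  obtain ⟨p, h1, h2, h3, h4, h5, h6⟩ := h
  refine ⟨p.reverse, h1.reverse, by simpa using h2, by simpa using h3, by simpa using h4,
    by simpa using h5, ?_⟩
  intro z hz hzz
  have := h6 z hz (by simpa using hzz)
  tauto

theorem SI.mono {V : Type*} {G : SimpleGraph V} {W W' M M' : Finset V} {L L' : ℕ}
    (h : SI G W M L) (hW : W ⊆ W') (hM : M' ⊆ M) (hL : L ≤ L') : SI G W' M' L' := by
  obtain ⟨h0, κ, h⟩ := h
  refine ⟨hM.trans (h0.trans hW), κ, fun x hx y hy hxy => ?_⟩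
  obtain ⟨p, h1, h2, h3, h4, h5, h6⟩ := h x (hM hx) y (hM hy) hxy
  exact ⟨p, h1, h2, h3.trans hL, h4, fun z hz => hW (h5 z hz), fun z hz => h6 z (hM hz)⟩

theorem SI.of_clique {V : Type*} {G : SimpleGraph V} {W M : Finset V} {L : ℕ} (hL : 1 ≤ L)
    (hMW : M ⊆ W) (h : ∀ x ∈ M, ∀ y ∈ M, x ≠ y → G.Adj x y) : SI G W M L := by
  refine ⟨hMW, id, fun x hx y hy hxy => ?_⟩
  refine ⟨(h x hx y hy hxy).toWalk, ?_, ?_, ?_, ?_, ?_, ?_⟩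
  · simp [hxy]
  · simp
  · simpa using hL
  · simp
  · simp only [SimpleGraph.Walk.support_cons, SimpleGraph.Walk.support_nil]
    intro z hz
    simp at hz
    rcases hz with rfl | rfl
    · exact hMW hx
    · exact hMW hy
  · intro z _ hz
    simpa using hz

open Classical in
theorem SI.add {V : Type*} {G : SimpleGraph V} {W W' M T : Finset V} {L : ℕ}
    (h : SI G W' M L) (hW : W' ⊆ W) (hT : T ⊆ W) (hTW : ∀ x ∈ T, x ∉ W') (κ₂ : Sym2 V → Sym2 V)
    (h1 : ∀ m ∈ M, ∀ z ∈ T, Lk G W (M ∪ T) L (fun e => κ₂ e = s(m, z) ∧ ∃ v ∈ e, v ∉ W') m z)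
    (h2 : ∀ x ∈ T, ∀ y ∈ T, x ≠ y → Lk G W (M ∪ T) L (fun e => κ₂ e = s(x, y) ∧ ∃ v ∈ e, v ∉ W') x y) :
    SI G W (M ∪ T) L := by
  obtain ⟨h0, κ, h⟩ := h
  refine ⟨Finset.union_subset (h0.trans hW) hT, fun e => if ∃ v ∈ e, v ∉ W' then κ₂ e else κ e, ?_⟩
  have aux : ∀ x y, Lk G W (M ∪ T) L (fun e => κ₂ e = s(x, y) ∧ ∃ v ∈ e, v ∉ W') x y →
      Lk G W (M ∪ T) L (fun e => (if ∃ v ∈ e, v ∉ W' then κ₂ e else κ e) = s(x, y)) x y := by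
    rintro x y ⟨p, p1, p2, p3, p4, p5⟩
    refine ⟨p, p1, p2, p3, fun e he => ?_, p5⟩
    obtain ⟨a, b⟩ := p4 e he
    simp only [if_pos b, a]
  intro x hx y hy hxy
  rw [Finset.mem_union] at hx hy
  rcases hx with hx | hx <;> rcases hy with hy | hy
  · obtain ⟨p, p1, p2, p3, p4, p5, p6⟩ := h x hx y hy hxy
    refine ⟨p, p1, p2, p3, fun e he => ?_, fun z hz => hW (p5 z hz), ?_⟩
    · have : ¬ ∃ v ∈ e, v ∉ W' := by
        rintro ⟨v, hv, hvW⟩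
        apply hvW
        apply p5
        induction e with | _ a b =>
        simp at hv
        rcases hv with rfl | rfl
        · exact p.fst_mem_support_of_mem_edges he
        · exact p.snd_mem_support_of_mem_edges he
      simp only [if_neg this]
      exact p4 e he
    · intro z hz hzp
      rw [Finset.mem_union] at hz
      rcases hz with hz | hz
      · exact p6 z hz hzp
      · exact absurd (p5 z hzp) (hTW z hz)
  · exact aux _ _ (h1 x hx y hy)
  · have := (aux _ _ (h1 y hy x hx)).symm
    rw [Sym2.eq_swap] at this
    exact this
  · exact aux _ _ (h2 x hx y hy hxy)

theorem SI.final {V : Type*} {G : SimpleGraph V} {W M : Finset V} {L : ℕ} (h : SI G W M L) :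
    StrongOddBoundedCliqueImmersion G M.card L := by
  obtain ⟨h0, κ, h⟩ := h
  have hne : ∀ u v : Fin M.card, u ≠ v → ((M.equivFin.symm u : V)) ≠ (M.equivFin.symm v : V) := by
    intro u v huv hh
    exact huv (M.equivFin.symm.injective (Subtype.ext hh))
  have hh : ∀ u v : Fin M.card, ∃ p : G.Walk (M.equivFin.symm u : V) (M.equivFin.symm v : V), u ≠ v →
     (p.IsPath ∧ Odd p.length ∧ p.length ≤ L ∧ (∀ e ∈ p.edges, κ e = s((M.equivFin.symm u : V), (M.equivFin.symm v : V))) ∧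
    (∀ z ∈ p.support, z ∈ W) ∧ (∀ z ∈ M, z ∈ p.support → z = (M.equivFin.symm u : V) ∨ z = (M.equivFin.symm v : V))) := by
    intro u v
    by_cases huv : u = v
    · subst huv
      exact ⟨SimpleGraph.Walk.nil, fun h => absurd rfl h⟩
    · obtain ⟨p, hp⟩ := h _ (M.equivFin.symm u).2 _ (M.equivFin.symm v).2 (hne u v huv)
      exact ⟨p, fun _ => hp⟩
  choose P hP using hh
  refine ⟨fun u => (M.equivFin.symm u : V), P, ?_, ?_, ?_, ?_, ?_, ?_⟩
  · intro u v huv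
    by_contra hc
    exact hne u v hc huv
  · intro u v huv
    exact (hP u v huv.ne).1
  · intro u v u' v' h1 h2 hd e he he'
    have a := (hP u v h1.ne).2.2.2.1 e he
    have b := (hP u' v' h2.ne).2.2.2.1 e he'
    rw [a, Sym2.eq_iff] at b
    have inj : ∀ u v : Fin M.card, ((M.equivFin.symm u : V)) = (M.equivFin.symm v : V) → u = v := by
      intro u v huv
      by_contra hc
      exact hne u v hc huv
    rcases b with ⟨b1, b2⟩ | ⟨b1, b2⟩
    · exact hd (by rw [inj _ _ b1, inj _ _ b2])
    · have c1 := inj _ _ b1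
      have c2 := inj _ _ b2
      subst c1 c2
      exact absurd h1 (not_lt.mpr h2.le)
  · intro u v huv
    exact (hP u v huv.ne).2.1
  · intro u v huv
    exact (hP u v huv.ne).2.2.1
  · intro u v w huv hw
    exact (hP u v huv.ne).2.2.2.2.2 _ (M.equivFin.symm w).2 hw

theorem walk_count {V : Type*} {K : SimpleGraph V} (I : Finset V) [DecidableEq V]
    (hK : ∀ x y, K.Adj x y → (x ∈ I ↔ y ∉ I)) : ∀ {x s : V} (p : K.Walk x s), s ∈ I →
    2 * (p.support.filter (· ∈ I)).length = p.length + (if x ∈ I then 2 else 1) := by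
  intro x s p hs
  induction p with
  | nil => simp [hs]
  | cons hadj p ih =>
    have := hK _ _ hadj
    have ih := ih hs
    rw [SimpleGraph.Walk.support_cons, List.filter_cons, SimpleGraph.Walk.length_cons]
    split_ifs at ih ⊢ <;> simp_all <;> omega

/-- owner colouring -/
noncomputable def kap {V : Type*} (S : Finset V) (o : V → Sym2 V) (d : Sym2 V) (e : Sym2 V) : Sym2 V :=
  open Classical in if h : ∃ v, v ∈ e ∧ v ∉ S then o h.choose else d

theorem kap_eq {V : Type*} {S : Finset V} {o : V → Sym2 V} {d : Sym2 V} {v c : V} (hv : v ∉ S) (hc : c ∈ S) :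
    kap S o d s(v, c) = o v := by
  have h : ∃ w, w ∈ s(v, c) ∧ w ∉ S := ⟨v, by simp, hv⟩
  unfold kap
  rw [dif_pos h]
  have h2 := h.choose_spec
  rw [Sym2.mem_iff] at h2
  rcases h2 with ⟨h3 | h3, h4⟩
  · rw [h3]
  · rw [h3] at h4
    exact absurd hc h4

open Classical in
theorem SI.step {V : Type*} {G : SimpleGraph V} {W M I : Finset V} {L : ℕ} {s : V}
    (hI : I ⊆ W) (hs : s ∈ I) (hL : 2 * I.card ≤ L + 1)
    (h : SI G (W \ I) M L)
    (hcut : ∀ X : Finset V, s ∉ X → (M.filter (fun m => I.filter (G.Adj m) ⊆ X)).card ≤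
      (((W \ I) \ M).filter (fun u => (∃ i ∈ I.filter (G.Adj u), i ∈ X) ∧ ∃ i ∈ I.filter (G.Adj u), i ∉ X)).card) :
    SI G W (insert s M) L := by
  obtain ⟨own, hown⟩ := cut_link s (fun u => I.filter (G.Adj u)) M _ ((W \ I) \ M) (fun u => I.filter (G.Adj u)) rfl hcut
  have hMW := h.1
  have : insert s M = M ∪ {s} := by ext; simp
  rw [this]
  set o : V → V := fun v => if v ∈ M then v else own v with ho
  refine SI.add h Finset.sdiff_subset (by simpa using hI hs) (by simp [hs]) (kap I (fun v => s(o v, s)) s(s, s)) ?_ ?_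
  · intro m hm z hz
    obtain rfl := Finset.mem_singleton.mp hz
    have hmI : m ∉ I := (Finset.mem_sdiff.mp (hMW hm)).2
    have hmW : m ∈ W := (Finset.mem_sdiff.mp (hMW hm)).1
    let D : V → Prop := fun v => v ∈ W ∧ v ∉ I ∧ o v = m ∧ (v ∈ M → v = m)
    let K : SimpleGraph V :=
      { Adj := fun x y => G.Adj x y ∧ ((x ∈ I ∧ D y) ∨ (y ∈ I ∧ D x))
        symm := ⟨fun x y hxy => ⟨hxy.1.symm, hxy.2.symm⟩⟩
        loopless := ⟨fun x hx => G.loopless.irrefl x hx.1⟩ }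
    have hKG : K ≤ G := fun x y hxy => hxy.1
    have hDm : D m := ⟨hmW, hmI, by simp [ho, hm], fun _ => rfl⟩
    have hreach : K.Reachable m z := by
      by_contra hcon
      obtain ⟨u, hu, hou, ⟨i, hi, hiX⟩, j, hj, hjX⟩ := hown m hm (I.filter (fun i => K.Reachable m i))
        (fun hh => hcon (Finset.mem_filter.mp hh).2) (by
          intro i hi
          rw [Finset.mem_filter] at hi ⊢
          refine ⟨hi.1, SimpleGraph.Adj.reachable (G := K) ⟨hi.2, Or.inr ⟨hi.1, hDm⟩⟩⟩)
      rw [Finset.mem_filter] at hi hj hiX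
      apply hjX
      rw [Finset.mem_filter]
      have hDu : D u := by
        rw [Finset.mem_sdiff, Finset.mem_sdiff] at hu
        refine ⟨hu.1.1, hu.1.2, ?_, fun hh => absurd hh hu.2⟩
        simp [ho, hu.2, hou]
      refine ⟨hj.1, hiX.2.trans ?_⟩
      have a1 : K.Adj i u := ⟨hi.2.symm, Or.inl ⟨hi.1, hDu⟩⟩
      have a2 : K.Adj u j := ⟨hj.2, Or.inr ⟨hj.1, hDu⟩⟩
      exact a1.reachable.trans a2.reachable
    obtain ⟨p, hp⟩ := hreach.exists_isPath
    have hbip : ∀ x y, K.Adj x y → (x ∈ I ↔ y ∉ I) := by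
      rintro x y ⟨_, ⟨h1, h2⟩ | ⟨h1, h2⟩⟩
      · exact ⟨fun _ => h2.2.1, fun _ => h1⟩
      · exact ⟨fun hx => absurd hx h2.2.1, fun hy => absurd h1 hy⟩
    have hcnt := walk_count I hbip p hs
    rw [if_neg hmI] at hcnt
    have hle : (p.support.filter (· ∈ I)).length ≤ I.card := by
      have hnd : (p.support.filter (· ∈ I)).Nodup := hp.support_nodup.filter _
      rw [← List.toFinset_card_of_nodup hnd]
      apply Finset.card_le_card
      intro x hx
      simpa using (List.mem_filter.mp (List.mem_toFinset.mp hx)).2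
    have hedge : ∀ x y, K.Adj x y → kap I (fun v => s(o v, z)) s(z, z) s(x, y) = s(m, z) ∧ ∃ v ∈ s(x, y), v ∉ W \ I := by
      rintro x y ⟨_, ⟨h1, h2⟩ | ⟨h1, h2⟩⟩
      · refine ⟨?_, x, by simp, by simp [h1]⟩
        rw [show s(x, y) = s(y, x) from Sym2.eq_swap, kap_eq h2.2.1 h1, h2.2.2.1]
      · refine ⟨?_, y, by simp, by simp [h1]⟩
        rw [kap_eq h2.2.1 h1, h2.2.2.1]
    have hsup : ∀ x ∈ p.support, x ∈ I ∨ D x := by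
      have : ∀ {x y : V} (p : K.Walk x y), y ∈ I → ∀ v ∈ p.support, v ∈ I ∨ D v := by
        intro x y p hy
        induction p with
        | nil => intro v hv; simp at hv; subst hv; exact Or.inl hy
        | cons hadj p ih =>
          intro v hv
          rw [SimpleGraph.Walk.support_cons, List.mem_cons] at hv
          rcases hv with rfl | hv
          · rcases hadj.2 with h1 | h1
            · exact Or.inl h1.1
            · exact Or.inr h1.2
          · exact ih hy v hv
      exact this p hs
    have hIM : ∀ x ∈ I, x ∉ M := fun x hx hxM => (Finset.mem_sdiff.mp (hMW hxM)).2 hx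
    · refine ⟨p.mapLe hKG, ?_, ?_, ?_, ?_, ?_, ?_⟩
      · exact hp.mapLe hKG
      · rw [SimpleGraph.Walk.length_mapLe]
        refine ⟨(p.support.filter (· ∈ I)).length - 1, by omega⟩
      · rw [SimpleGraph.Walk.length_mapLe]
        omega
      · intro e he
        rw [SimpleGraph.Walk.edges_mapLe_eq_edges] at he
        have := p.edges_subset_edgeSet he
        induction e with | _ a b =>
        exact hedge a b this
      · intro x hx
        rw [SimpleGraph.Walk.support_mapLe_eq_support] at hx
        rcases hsup x hx with h | h
        · exact hI h
        · exact h.1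
      · intro x hx hxp
        rw [SimpleGraph.Walk.support_mapLe_eq_support] at hxp
        rw [Finset.mem_union, Finset.mem_singleton] at hx
        rcases hx with hx | hx
        · rcases hsup x hxp with h | h
          · exact absurd hx (hIM x h)
          · exact Or.inl (h.2.2.2 hx)
        · exact Or.inr hx
  · intro x hx y hy hxy
    rw [Finset.mem_singleton] at hx hy
    exact absurd (hx.trans hy.symm) hxy

theorem odd_struct {V : Type*} (H : SimpleGraph V)
    (tri : ∀ a b c, H.Adj a b → H.Adj b c → H.Adj a c → False) (hcol : ¬ H.Colorable 2) :
    ∃ p0 p1 p2 p3 p4, H.Adj p0 p1 ∧ H.Adj p1 p2 ∧ H.Adj p2 p3 ∧ H.Adj p3 p4 ∧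
      (∀ v, H.Adj v p0 → H.Adj v p4 → False) ∧
      (H.Adj p4 p0 ∨ ∀ v, H.Adj v p0 → H.Adj v p3 → False) := by
  classical
  rw [SimpleGraph.two_colorable_iff_forall_loop_even] at hcol
  push Not at hcol
  have hex : ∃ L, ∃ u, ∃ w : H.Walk u u, w.length = L ∧ Odd L := by
    obtain ⟨u, w, hw⟩ := hcol
    exact ⟨_, u, w, rfl, by simpa using hw⟩
  obtain ⟨p0, w, hw, hodd⟩ := Nat.find_spec hex
  have hmin : ∀ u (w : H.Walk u u), Odd w.length → Nat.find hex ≤ w.length := by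
    intro u w hw
    exact Nat.find_min' hex ⟨u, w, rfl, hw⟩
  set L := Nat.find hex
  have dest : ∀ {a b : V} (w : H.Walk a b) (n : ℕ), w.length = n + 1 →
      ∃ c, H.Adj a c ∧ ∃ q : H.Walk c b, q.length = n := by
    intro a b w n hn
    cases w with
    | nil => simp at hn
    | cons h q => exact ⟨_, h, q, by simpa using hn⟩
  obtain ⟨r, hr⟩ := hodd
  have h5 : 2 ≤ r := by
    rcases r with _ | _ | r
    · exact absurd (SimpleGraph.Walk.adj_of_length_eq_one (by omega : w.length = 1)) (H.loopless.irrefl _)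
    · obtain ⟨a, h1, q, hq⟩ := dest w 2 (by omega)
      obtain ⟨b, h2, q, hq⟩ := dest q 1 (by omega)
      have h3 := SimpleGraph.Walk.adj_of_length_eq_one hq
      exact absurd (tri _ _ _ h1 h2 h3.symm) id
    · omega
  obtain ⟨p1, h1, q, hq⟩ := dest w (2 * r) (by omega)
  obtain ⟨p2, h2, q, hq⟩ := dest q (2 * r - 1) (by omega)
  obtain ⟨p3, h3, q, hq⟩ := dest q (2 * r - 2) (by omega)
  obtain ⟨p4, h4, q, hq⟩ := dest q (2 * r - 3) (by omega)
  refine ⟨p0, p1, p2, p3, p4, h1, h2, h3, h4, ?_, ?_⟩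
  · intro v hv0 hv4
    have := hmin v (SimpleGraph.Walk.cons hv4 (q.concat hv0.symm)) (by
      simp only [SimpleGraph.Walk.length_cons, SimpleGraph.Walk.length_concat, hq]
      exact ⟨r - 1, by omega⟩)
    simp only [SimpleGraph.Walk.length_cons, SimpleGraph.Walk.length_concat, hq] at this
    omega
  · by_cases hr2 : r = 2
    · left
      exact SimpleGraph.Walk.adj_of_length_eq_one (by omega : q.length = 1)
    · right
      intro v hv0 hv3
      have := hmin v (SimpleGraph.Walk.cons hv0 (SimpleGraph.Walk.cons h1 (SimpleGraph.Walk.cons h2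
        (SimpleGraph.Walk.cons h3 hv3.symm.toWalk)))) (by simp; decide)
      simp at this
      omega

set_option maxHeartbeats 1000000 in
open Classical in
theorem SI.five {V : Type*} {G H : SimpleGraph V} {W S M : Finset V} {p0 p1 p2 p3 p4 : V}
    (hH : ∀ x y, H.Adj x y ↔ x ∈ W ∧ y ∈ W ∧ x ≠ y ∧ ¬ G.Adj x y)
    (tri : ∀ a b c, H.Adj a b → H.Adj b c → H.Adj a c → False)
    (hS : S ⊆ W) (s0 : p0 ∈ S) (s1 : p1 ∈ S) (s2 : p2 ∈ S) (s3 : p3 ∈ S) (s4 : p4 ∈ S)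
    (a01 : H.Adj p0 p1) (a12 : H.Adj p1 p2) (a23 : H.Adj p2 p3) (a34 : H.Adj p3 p4)
    (h04 : ∀ v, H.Adj v p0 → H.Adj v p4 → False)
    (h : SI G (W \ S) M 3)
    (hZ : M.card + (((W \ S) \ M).filter (fun v => H.Adj v p0 ∧ H.Adj v p3)).card ≤ ((W \ S) \ M).card)
    (hd1 : ((W \ S).filter (fun v => H.Adj v p1)).card ≤ M.card)
    (hd2 : ((W \ S).filter (fun v => H.Adj v p2)).card ≤ M.card) :
    SI G W (M ∪ {p1, p2}) 3 := by
  have hMW := h.1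
  have n02 : p0 ≠ p2 := by rintro rfl; exact h04 p3 a23.symm a34
  have n13 : p1 ≠ p3 := by rintro rfl; exact h04 p1 a01.symm a34
  have n24 : p2 ≠ p4 := by rintro rfl; exact h04 p1 a01.symm a12
  have n03 : p0 ≠ p3 := by rintro rfl; exact tri _ _ _ a01 a12 a23.symm
  have n14 : p1 ≠ p4 := by rintro rfl; exact tri _ _ _ a12 a23 a34.symm
  have gadj : ∀ x y, x ∈ W → y ∈ W → x ≠ y → ¬ H.Adj x y → G.Adj x y := by
    intro x y hx hy hxy hn
    by_contra hc
    exact hn ((hH x y).2 ⟨hx, hy, hxy, hc⟩)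
  set U := (W \ S) \ M with hU
  set Us := U.filter (fun v => ¬ (H.Adj v p0 ∧ H.Adj v p3)) with hUs
  have hUsc : M.card ≤ Us.card := by
    have := Finset.card_filter_add_card_filter_not (s := U) (fun v => H.Adj v p0 ∧ H.Adj v p3)
    rw [hUs]
    omega
  -- available sets
  let Pz : V → Finset V := fun z => Us.filter (fun v => ¬ H.Adj v z)
  have hPz : ∀ z, ((W \ S).filter (fun v => H.Adj v z)).card ≤ M.card →
      (M.filter (fun v => H.Adj v z)).card ≤ (Pz z).card := by
    intro z hz
    have e1 := Finset.card_filter_add_card_filter_not (s := Us) (fun v => H.Adj v z)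
    have e2 : (M.filter (fun v => H.Adj v z)).card + (Us.filter (fun v => H.Adj v z)).card ≤
        ((W \ S).filter (fun v => H.Adj v z)).card := by
      rw [← Finset.card_union_of_disjoint]
      · apply Finset.card_le_card
        intro v hv
        simp only [Finset.mem_union, Finset.mem_filter, hUs, hU, Finset.mem_sdiff] at hv ⊢
        rcases hv with hv | hv
        · exact ⟨Finset.mem_sdiff.mp (hMW hv.1), hv.2⟩
        · exact ⟨hv.1.1.1, hv.2⟩
      · rw [Finset.disjoint_left]
        intro v hv hv2
        simp only [Finset.mem_filter, hUs, hU, Finset.mem_sdiff] at hv hv2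
        exact hv2.1.1.2 hv.1
    change _ ≤ (Us.filter (fun v => ¬ H.Adj v z)).card
    omega
  let T : V → V := fun m => if H.Adj m p1 then p1 else p2
  let D := M.filter (fun m => H.Adj m p1 ∨ H.Adj m p2)
  have hall : ∃ g : D → V, Function.Injective g ∧ ∀ x : D, g x ∈ Pz (T x) := by
    rw [← Finset.all_card_le_biUnion_card_iff_exists_injective (fun x : D => Pz (T x))]
    intro A
    by_cases hx : ∃ x ∈ A, H.Adj x.1 p1
    · by_cases hy : ∃ y ∈ A, ¬ H.Adj y.1 p1
      · obtain ⟨x, hxA, hx⟩ := hx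
        obtain ⟨y, hyA, hy⟩ := hy
        have c1 : A.card ≤ M.card := by
          rw [← Finset.card_map (Function.Embedding.subtype _)]
          apply Finset.card_le_card
          intro v hv
          rw [Finset.mem_map] at hv
          obtain ⟨w, _, rfl⟩ := hv
          exact (Finset.mem_filter.mp w.2).1
        refine c1.trans (hUsc.trans (Finset.card_le_card ?_))
        intro u hu
        rw [Finset.mem_biUnion]
        by_cases hu1 : H.Adj u p1
        · refine ⟨y, hyA, ?_⟩
          have : T y = p2 := if_neg hy
          rw [this]
          exact Finset.mem_filter.mpr ⟨hu, fun h2 => tri _ _ _ hu1 a12 h2⟩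
        · refine ⟨x, hxA, ?_⟩
          have : T x = p1 := if_pos hx
          rw [this]
          exact Finset.mem_filter.mpr ⟨hu, hu1⟩
      · push Not at hy
        obtain ⟨x, hxA, hx⟩ := hx
        have c1 : A.card ≤ (M.filter (fun v => H.Adj v p1)).card := by
          rw [← Finset.card_map (Function.Embedding.subtype _)]
          apply Finset.card_le_card
          intro v hv
          rw [Finset.mem_map] at hv
          obtain ⟨w, hw, rfl⟩ := hv
          exact Finset.mem_filter.mpr ⟨(Finset.mem_filter.mp w.2).1, hy w hw⟩
        refine c1.trans ((hPz p1 hd1).trans (Finset.card_le_card ?_))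
        intro u hu
        rw [Finset.mem_biUnion]
        refine ⟨x, hxA, ?_⟩
        have : T x = p1 := if_pos hx
        rw [this]
        exact hu
    · push Not at hx
      rcases A.eq_empty_or_nonempty with rfl | ⟨y, hyA⟩
      · simp
      have c1 : A.card ≤ (M.filter (fun v => H.Adj v p2)).card := by
        rw [← Finset.card_map (Function.Embedding.subtype _)]
        apply Finset.card_le_card
        intro v hv
        rw [Finset.mem_map] at hv
        obtain ⟨w, hw, rfl⟩ := hv
        have hw2 := Finset.mem_filter.mp w.2
        exact Finset.mem_filter.mpr ⟨hw2.1, hw2.2.resolve_left (hx w hw)⟩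
      refine c1.trans ((hPz p2 hd2).trans (Finset.card_le_card ?_))
      intro u hu
      rw [Finset.mem_biUnion]
      refine ⟨y, hyA, ?_⟩
      have : T y = p2 := if_neg (hx y hyA)
      rw [this]
      exact hu
  obtain ⟨g, ginj, hg⟩ := hall
  let o : V → Sym2 V := fun v => if v ∈ M then s(v, T v) else
    if hv : ∃ m : D, g m = v then s(hv.choose.1, T hv.choose.1) else s(v, v)
  have oM : ∀ v ∈ M, o v = s(v, T v) := fun v hv => if_pos hv
  have oU : ∀ m : D, g m ∉ M → o (g m) = s(m.1, T m.1) := by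
    intro m hm
    have hv : ∃ m' : D, g m' = g m := ⟨m, rfl⟩
    have : o (g m) = s(hv.choose.1, T hv.choose.1) := by
      change (if _ then _ else _) = _
      rw [if_neg hm, dif_pos hv]
    rw [this, ginj hv.choose_spec]
  let κ₂ : Sym2 V → Sym2 V := fun e => if ∃ m ∈ M, e = s(m, p1) ∨ e = s(m, p2) then e else kap S o s(p1, p2) e
  have MS : ∀ m ∈ M, m ∉ S := fun m hm => (Finset.mem_sdiff.mp (hMW hm)).2
  have MW : ∀ m ∈ M, m ∈ W := fun m hm => (Finset.mem_sdiff.mp (hMW hm)).1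
  have k1 : ∀ m ∈ M, ∀ z, z = p1 ∨ z = p2 → κ₂ s(m, z) = s(m, z) := by
    intro m hm z hz
    apply if_pos
    refine ⟨m, hm, ?_⟩
    rcases hz with rfl | rfl <;> simp
  have k2 : ∀ v c, v ∉ S → c ∈ S → (v ∈ M → c ≠ p1 ∧ c ≠ p2) → κ₂ s(v, c) = o v := by
    intro v c hv hc hn
    have : ¬ ∃ m ∈ M, s(v, c) = s(m, p1) ∨ s(v, c) = s(m, p2) := by
      rintro ⟨m, hm, he⟩
      simp only [Sym2.eq_iff] at he
      rcases he with (⟨rfl, rfl⟩ | ⟨rfl, rfl⟩) | (⟨rfl, rfl⟩ | ⟨rfl, rfl⟩)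
      · exact (hn hm).1 rfl
      · exact hv s1
      · exact (hn hm).2 rfl
      · exact hv s2
    change (if _ then _ else _) = _
    rw [if_neg this, kap_eq hv hc]
  have k3 : ∀ c c', c ∈ S → c' ∈ S → κ₂ s(c, c') = s(p1, p2) := by
    intro c c' hc hc'
    have : ¬ ∃ m ∈ M, s(c, c') = s(m, p1) ∨ s(c, c') = s(m, p2) := by
      rintro ⟨m, hm, he⟩
      have := MS m hm
      simp only [Sym2.eq_iff] at he
      rcases he with (⟨rfl, rfl⟩ | ⟨rfl, rfl⟩) | (⟨rfl, rfl⟩ | ⟨rfl, rfl⟩) <;> contradiction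
    change (if _ then _ else _) = _
    rw [if_neg this]
    unfold kap
    rw [dif_neg]
    rintro ⟨v, hv, hvS⟩
    rw [Sym2.mem_iff] at hv
    rcases hv with rfl | rfl <;> contradiction
  have path1 : ∀ m ∈ M, ∀ z, z = p1 ∨ z = p2 → z ∈ S → G.Adj m z →
      Lk G W (M ∪ {p1, p2}) 3 (fun e => κ₂ e = s(m, z) ∧ ∃ v ∈ e, v ∉ W \ S) m z := by
    intro m hm z hz hzS hadj
    refine ⟨hadj.toWalk, by simp [hadj.ne], by simp, by simp, ?_, ?_, ?_⟩
    · intro e he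
      simp at he
      subst he
      exact ⟨k1 m hm z hz, z, by simp, by simp [hzS]⟩
    · intro v hv
      simp at hv
      rcases hv with rfl | rfl
      · exact MW _ hm
      · exact hS hzS
    · intro v _ hv
      simpa using hv
  have path3 : ∀ m, ∀ hmD : m ∈ D, ∀ z, z = p1 ∨ z = p2 → z ∈ S → T m = z → ∀ c ∈ S, c ≠ p1 → c ≠ p2 →
      G.Adj m c → G.Adj c (g ⟨m, hmD⟩) → 
      Lk G W (M ∪ {p1, p2}) 3 (fun e => κ₂ e = s(m, z) ∧ ∃ v ∈ e, v ∉ W \ S) m z := by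
    intro m hmD z hz hzS hT c hc hc1 hc2 hmc hcu
    have hm : m ∈ M := (Finset.mem_filter.mp hmD).1
    have hu := hg ⟨m, hmD⟩
    have oU' := oU ⟨m, hmD⟩
    set u := g ⟨m, hmD⟩
    change u ∈ Pz (T m) at hu
    rw [hT] at hu
    simp only [Pz, hUs, hU, Finset.mem_filter, Finset.mem_sdiff] at hu
    obtain ⟨⟨⟨⟨huW, huS⟩, huM⟩, _⟩, huz⟩ := hu
    have hmS := MS m hm
    have huz' : G.Adj u z := gadj u z huW (hS hzS) (by rintro rfl; exact huS hzS) huz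
    have oU'' := oU' huM
    simp only [hT] at oU''
    have hcz : c ≠ z := by rcases hz with rfl | rfl <;> assumption
    have hmz : m ≠ z := by rintro rfl; exact hmS hzS
    have hmu : m ≠ u := by intro hh; rw [hh] at hm; exact huM hm
    refine ⟨SimpleGraph.Walk.cons hmc (SimpleGraph.Walk.cons hcu huz'.toWalk), ?_, ?_, ?_, ?_, ?_, ?_⟩
    · rw [SimpleGraph.Walk.isPath_def]
      simp [hmc.ne, hmu, hmz, hcu.ne, hcz, huz'.ne]
    · simp; decide
    · simp
    · intro e he
      simp at he
      rcases he with rfl | rfl | rfl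
      · refine ⟨?_, c, by simp, by simp [hc]⟩
        rw [k2 m c hmS hc (fun _ => ⟨hc1, hc2⟩), oM m hm, hT]
      · refine ⟨?_, c, by simp, by simp [hc]⟩
        rw [show s(c, u) = s(u, c) from Sym2.eq_swap, k2 u c huS hc (fun h => absurd h huM), oU'']
      · refine ⟨?_, z, by simp, by simp [hzS]⟩
        rw [k2 u z huS hzS (fun h => absurd h huM), oU'']
    · intro v hv
      simp at hv
      rcases hv with rfl | rfl | rfl | rfl
      · exact MW _ hm
      · exact hS hc
      · exact huW
      · exact hS hzS
    · intro v hvM hv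
      simp at hv
      rcases hv with rfl | rfl | rfl | rfl
      · exact Or.inl rfl
      · simp [hc1, hc2] at hvM
        exact absurd hc (MS _ hvM)
      · simp [huM] at hvM
        rcases hvM with hh | hh <;> rw [hh] at huS <;> contradiction
      · exact Or.inr rfl
  have hmc : ∀ m ∈ M, ∀ c ∈ S, ¬ H.Adj m c → G.Adj m c := by
    intro m hm c hc hn
    exact gadj m c (MW m hm) (hS hc) (by rintro rfl; exact MS _ hm hc) hn
  have hguse : ∀ x : D, ∀ c ∈ S, ¬ H.Adj (g x) c → G.Adj c (g x) := by
    intro x c hc hn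
    have hu := hg x
    simp only [Pz, hUs, hU, Finset.mem_filter, Finset.mem_sdiff] at hu
    exact (gadj _ c hu.1.1.1.1 (hS hc) (by intro hh; rw [hh] at hu; exact hu.1.1.1.2 hc) hn).symm
  have hgZ : ∀ x : D, ¬ (H.Adj (g x) p0 ∧ H.Adj (g x) p3) := by
    intro x
    have hu := hg x
    simp only [Pz, hUs, hU, Finset.mem_filter, Finset.mem_sdiff] at hu
    exact hu.1.2
  refine SI.add h Finset.sdiff_subset ?_ ?_ κ₂ ?_ ?_
  · intro v hv
    simp at hv
    rcases hv with rfl | rfl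
    · exact hS s1
    · exact hS s2
  · intro v hv
    simp at hv
    rcases hv with rfl | rfl <;> simp [s1, s2]
  · intro m hm z hz
    simp only [Finset.mem_insert, Finset.mem_singleton] at hz
    by_cases hmz : H.Adj m z
    · have hmD : m ∈ D := by
        refine Finset.mem_filter.mpr ⟨hm, ?_⟩
        rcases hz with rfl | rfl
        · exact Or.inl hmz
        · exact Or.inr hmz
      have fin : ∀ c ∈ S, c ≠ p1 → c ≠ p2 → T m = z → z ∈ S → ¬ H.Adj m c → ¬ H.Adj (g ⟨m, hmD⟩) c →
          Lk G W (M ∪ {p1, p2}) 3 (fun e => κ₂ e = s(m, z) ∧ ∃ v ∈ e, v ∉ W \ S) m z := by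
        intro c hc hc1 hc2 hT hzS n1 n2
        exact path3 m hmD z hz hzS hT c hc hc1 hc2 (hmc m hm c hc n1) (hguse _ c hc n2)
      have q0 := fin p0 s0 a01.ne n02
      have q3 := fin p3 s3 n13.symm a23.ne.symm
      have q4 := fin p4 s4 n14.symm n24.symm
      have u1 := hgZ ⟨m, hmD⟩
      have u2 := h04 (g ⟨m, hmD⟩)
      have u3 : H.Adj (g ⟨m, hmD⟩) p3 → H.Adj (g ⟨m, hmD⟩) p4 → False := fun x y => tri _ _ _ x a34 y
      have v3 : H.Adj m p3 → H.Adj m p4 → False := fun x y => tri _ _ _ x a34 y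
      have v0 := h04 m
      have w0 : H.Adj m p1 → ¬ H.Adj m p0 := fun x y => tri _ _ _ y a01 x
      have w3 : H.Adj m p2 → ¬ H.Adj m p3 := fun x y => tri _ _ _ x a23 y
      have w2 : H.Adj m p1 → ¬ H.Adj m p2 := fun x y => tri _ _ _ x a12 y
      rcases hz with hz | hz <;> subst hz
      · have hT : T m = z := if_pos hmz
        have n0 := w0 hmz
        by_cases b0 : H.Adj (g ⟨m, hmD⟩) p0
        · by_cases b3 : H.Adj m p3
          · exact q4 hT s1 (v3 b3) (u2 b0)
          · exact q3 hT s1 b3 (fun hh => u1 ⟨b0, hh⟩)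
        · exact q0 hT s1 n0 b0
      · have hT : T m = z := if_neg (fun hh => w2 hh hmz)
        have n3 := w3 hmz
        by_cases b3 : H.Adj (g ⟨m, hmD⟩) p3
        · by_cases b0 : H.Adj m p0
          · exact q4 hT s2 (v0 b0) (u3 b3)
          · exact q0 hT s2 b0 (fun hh => u1 ⟨hh, b3⟩)
        · exact q3 hT s2 n3 b3
    · have hzS : z ∈ S := by rcases hz with rfl | rfl <;> assumption
      exact path1 m hm z hz hzS (hmc m hm z hzS hmz)
  · have main : Lk G W (M ∪ {p1, p2}) 3 (fun e => κ₂ e = s(p1, p2) ∧ ∃ v ∈ e, v ∉ W \ S) p1 p2 := by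
      have g13 : G.Adj p1 p3 := gadj _ _ (hS s1) (hS s3) n13 (fun hh => tri _ _ _ a12 a23 hh)
      have g30 : G.Adj p3 p0 := gadj _ _ (hS s3) (hS s0) n03.symm (fun hh => h04 p3 hh a34)
      have g02 : G.Adj p0 p2 := gadj _ _ (hS s0) (hS s2) n02 (fun hh => tri _ _ _ a01 a12 hh)
      refine ⟨SimpleGraph.Walk.cons g13 (SimpleGraph.Walk.cons g30 g02.toWalk), ?_, ?_, ?_, ?_, ?_, ?_⟩
      · rw [SimpleGraph.Walk.isPath_def]
        simp [n13, a01.ne.symm, a12.ne, n03.symm, a23.ne.symm, n02]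
      · simp; decide
      · simp
      · intro e he
        simp at he
        rcases he with rfl | rfl | rfl
        · exact ⟨k3 _ _ s1 s3, p1, by simp, by simp [s1]⟩
        · exact ⟨k3 _ _ s3 s0, p3, by simp, by simp [s3]⟩
        · exact ⟨k3 _ _ s0 s2, p0, by simp, by simp [s0]⟩
      · intro v hv
        simp at hv
        rcases hv with rfl | rfl | rfl | rfl <;> apply hS <;> assumption
      · intro v hvM hv
        simp at hv
        rcases hv with rfl | rfl | rfl | rfl
        · exact Or.inl rfl
        · simp [n13.symm, a23.ne.symm] at hvM
          exact absurd s3 (MS _ hvM)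
        · simp [a01.ne, n02] at hvM
          exact absurd s0 (MS _ hvM)
        · exact Or.inr rfl
    intro x hx y hy hxy
    simp only [Finset.mem_insert, Finset.mem_singleton] at hx hy
    rcases hx with rfl | rfl <;> rcases hy with rfl | rfl
    · exact absurd rfl hxy
    · exact main
    · have := main.symm
      rw [show s(y, x) = s(x, y) from Sym2.eq_swap] at this
      exact this
    · exact absurd rfl hxy

open Classical in
theorem pent_aux (A0 A1 A2 A3 A4 : Prop) (n01 : A0 → ¬ A1) (n12 : A1 → ¬ A2) (n23 : A2 → ¬ A3)
    (n34 : A3 → ¬ A4) (n40 : A4 → ¬ A0) :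
    (if A0 ∧ A3 then 1 else 0) + (if A1 ∧ A4 then 1 else 0) + (if A2 ∧ A0 then 1 else 0) +
      (if A3 ∧ A1 then 1 else 0) + (if A4 ∧ A2 then 1 else 0) ≤ 1 := by
  by_cases A0 <;> by_cases A1 <;> by_cases A2 <;> by_cases A3 <;> by_cases A4 <;> simp_all

open Classical in
theorem exists_max_sub {V : Type*} (W : Finset V) (P : Finset V → Prop) (h : P ∅) :
    ∃ I ⊆ W, P I ∧ ∀ J ⊆ W, P J → J.card ≤ I.card := by
  obtain ⟨I, hI, hm⟩ := Finset.exists_max_image (W.powerset.filter P) Finset.card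
    ⟨∅, by simp [h]⟩
  rw [Finset.mem_filter, Finset.mem_powerset] at hI
  exact ⟨I, hI.1, hI.2, fun J hJ hP => hm J (Finset.mem_filter.mpr ⟨Finset.mem_powerset.mpr hJ, hP⟩)⟩

open Classical in
theorem alpha_two {V : Type*} (G : SimpleGraph V) : ∀ (k : ℕ) (W : Finset V),
    (∀ I ⊆ W, (∀ x ∈ I, ∀ y ∈ I, ¬ G.Adj x y) → I.card ≤ 2) → 5 * k ≤ W.card →
    ∃ M : Finset V, M.card = 2 * k ∧ SI G W M 3 := by
  intro k
  induction k with
  | zero =>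
    intro W _ _
    exact ⟨∅, by simp, by simp, id, by simp⟩
  | succ k ih =>
    intro W hW hcard
    by_contra hno
    have clq : ∀ C ⊆ W, (∀ x ∈ C, ∀ y ∈ C, x ≠ y → G.Adj x y) → C.card ≤ 2 * k + 1 := by
      intro C hC hcl
      by_contra hlt
      obtain ⟨M, hMC, hM⟩ := Finset.exists_subset_card_eq (show 2 * (k + 1) ≤ C.card by omega)
      exact hno ⟨M, hM, SI.of_clique (by norm_num) (hMC.trans hC)
        (fun x hx y hy hxy => hcl x (hMC hx) y (hMC hy) hxy)⟩
    obtain ⟨H, hH⟩ : ∃ H : SimpleGraph V, ∀ x y, H.Adj x y ↔ x ∈ W ∧ y ∈ W ∧ x ≠ y ∧ ¬ G.Adj x y :=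
      ⟨{ Adj := fun x y => x ∈ W ∧ y ∈ W ∧ x ≠ y ∧ ¬ G.Adj x y
         symm := ⟨fun x y h => ⟨h.2.1, h.1, h.2.2.1.symm, fun hh => h.2.2.2 hh.symm⟩⟩
         loopless := ⟨fun x h => h.2.2.1 rfl⟩ }, fun _ _ => Iff.rfl⟩
    have tri : ∀ a b c, H.Adj a b → H.Adj b c → H.Adj a c → False := by
      intro a b c hab hbc hac
      have h3 : ({a, b, c} : Finset V).card = 3 := by
        rw [Finset.card_eq_three]
        exact ⟨a, b, c, hab.ne, hac.ne, hbc.ne, rfl⟩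
      have := hW {a, b, c} (by
        intro x hx
        simp at hx
        rcases hx with rfl | rfl | rfl
        · exact ((hH _ _).1 hab).1
        · exact ((hH _ _).1 hab).2.1
        · exact ((hH _ _).1 hbc).2.1) (by
        have e1 := ((hH _ _).1 hab).2.2.2
        have e2 := ((hH _ _).1 hbc).2.2.2
        have e3 := ((hH _ _).1 hac).2.2.2
        intro x hx y hy
        simp at hx hy
        rcases hx with rfl | rfl | rfl <;> rcases hy with rfl | rfl | rfl <;>
          first | exact G.loopless.irrefl _ | assumption | (intro hh; exact absurd hh.symm (by assumption)))
      omega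
    have hcol : ¬ H.Colorable 2 := by
      rintro ⟨C⟩
      have cl : ∀ A ⊆ W, (∀ x ∈ A, ∀ y ∈ A, C x = C y) → A.card ≤ 2 * k + 1 := by
        intro A hA hQ
        apply clq _ hA
        intro x hx y hy hxy
        by_contra hn
        have : H.Adj x y := (hH _ _).2 ⟨hA hx, hA hy, hxy, hn⟩
        exact C.valid this (hQ _ hx _ hy)
      have e1 := cl (W.filter (fun v => C v = 0)) (Finset.filter_subset _ _) (by
        intro x hx y hy
        rw [(Finset.mem_filter.mp hx).2, (Finset.mem_filter.mp hy).2])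
      have e2 := cl (W.filter (fun v => ¬ C v = 0)) (Finset.filter_subset _ _) (by
        intro x hx y hy
        have h1 := (Finset.mem_filter.mp hx).2
        have h2 := (Finset.mem_filter.mp hy).2
        omega)
      have e3 := Finset.card_filter_add_card_filter_not (s := W) (fun v => C v = 0)
      omega
    obtain ⟨p0, p1, p2, p3, p4, a01, a12, a23, a34, h04, hcase⟩ := odd_struct H tri hcol
    set S : Finset V := {p0, p1, p2, p3, p4} with hS
    have s0 : p0 ∈ S := by simp [hS]
    have s1 : p1 ∈ S := by simp [hS]
    have s2 : p2 ∈ S := by simp [hS]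
    have s3 : p3 ∈ S := by simp [hS]
    have s4 : p4 ∈ S := by simp [hS]
    have hSW : S ⊆ W := by
      intro x hx
      simp [hS] at hx
      rcases hx with rfl | rfl | rfl | rfl | rfl
      · exact ((hH _ _).1 a01).1
      · exact ((hH _ _).1 a12).1
      · exact ((hH _ _).1 a23).1
      · exact ((hH _ _).1 a34).1
      · exact ((hH _ _).1 a34).2.1
    have hS5 : S.card ≤ 5 := Finset.card_le_five
    have hWS : (W \ S).card = W.card - S.card := Finset.card_sdiff_of_subset hSW
    obtain ⟨M, hM, hSI⟩ := ih (W \ S) (fun I hI h => hW I (hI.trans Finset.sdiff_subset) h) (by omega)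
    have hU : ((W \ S) \ M).card = (W \ S).card - M.card := Finset.card_sdiff_of_subset hSI.1
    have deg : ∀ p q, H.Adj p q → q ∈ S → ((W \ S).filter (fun v => H.Adj v p)).card ≤ M.card := by
      intro p q hpq hq
      have c1 := clq (W.filter (fun v => H.Adj v p)) (Finset.filter_subset _ _) (by
        intro x hx y hy hxy
        rw [Finset.mem_filter] at hx hy
        by_contra hn
        exact tri x y p ((hH _ _).2 ⟨hx.1, hy.1, hxy, hn⟩) hy.2 hx.2)
      have c2 : ((W \ S).filter (fun v => H.Adj v p)) ⊆ (W.filter (fun v => H.Adj v p)).erase q := by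
        intro x hx
        rw [Finset.mem_filter, Finset.mem_sdiff] at hx
        rw [Finset.mem_erase, Finset.mem_filter]
        exact ⟨by rintro rfl; exact hx.1.2 hq, hx.1.1, hx.2⟩
      have c3 := Finset.card_le_card c2
      rw [Finset.card_erase_of_mem (Finset.mem_filter.mpr ⟨((hH _ _).1 hpq).2.1, hpq.symm⟩)] at c3
      omega
    have finish : ∀ q0 q1 q2 q3 q4, q0 ∈ S → q1 ∈ S → q2 ∈ S → q3 ∈ S → q4 ∈ S →
        H.Adj q0 q1 → H.Adj q1 q2 → H.Adj q2 q3 → H.Adj q3 q4 →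
        (∀ v, H.Adj v q0 → H.Adj v q4 → False) →
        5 * (((W \ S) \ M).filter (fun v => H.Adj v q0 ∧ H.Adj v q3)).card ≤ ((W \ S) \ M).card → False := by
      intro q0 q1 q2 q3 q4 t0 t1 t2 t3 t4 b01 b12 b23 b34 hh hz
      have := SI.five hH tri hSW t0 t1 t2 t3 t4 b01 b12 b23 b34 hh hSI (by omega)
        (deg q1 q0 b01.symm t0) (deg q2 q1 b12.symm t1)
      refine hno ⟨_, ?_, this⟩
      have hMS : ∀ m ∈ M, m ∉ S := fun m hm => (Finset.mem_sdiff.mp (hSI.1 hm)).2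
      rw [Finset.card_union_of_disjoint, Finset.card_pair b12.ne, hM]
      · ring
      · rw [Finset.disjoint_left]
        intro x hx hx2
        simp at hx2
        rcases hx2 with rfl | rfl
        · exact hMS _ hx t1
        · exact hMS _ hx t2
    rcases hcase with h40 | h03
    · have hsum : (((W \ S) \ M).filter (fun v => H.Adj v p0 ∧ H.Adj v p3)).card +
        (((W \ S) \ M).filter (fun v => H.Adj v p1 ∧ H.Adj v p4)).card +
        (((W \ S) \ M).filter (fun v => H.Adj v p2 ∧ H.Adj v p0)).card +
        (((W \ S) \ M).filter (fun v => H.Adj v p3 ∧ H.Adj v p1)).card +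
        (((W \ S) \ M).filter (fun v => H.Adj v p4 ∧ H.Adj v p2)).card ≤ ((W \ S) \ M).card := by
        simp only [Finset.card_filter, ← Finset.sum_add_distrib]
        rw [Finset.card_eq_sum_ones]
        apply Finset.sum_le_sum
        intro v _
        have n01 : H.Adj v p0 → ¬ H.Adj v p1 := fun x y => tri _ _ _ x a01 y
        have n12 : H.Adj v p1 → ¬ H.Adj v p2 := fun x y => tri _ _ _ x a12 y
        have n23 : H.Adj v p2 → ¬ H.Adj v p3 := fun x y => tri _ _ _ x a23 y
        have n34 : H.Adj v p3 → ¬ H.Adj v p4 := fun x y => tri _ _ _ x a34 y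
        have n40 : H.Adj v p4 → ¬ H.Adj v p0 := fun x y => tri _ _ _ x h40 y
        exact pent_aux _ _ _ _ _ n01 n12 n23 n34 n40
      have f0 := not_le.mp (finish p0 p1 p2 p3 p4 s0 s1 s2 s3 s4 a01 a12 a23 a34 h04)
      have f1 := not_le.mp (finish p1 p2 p3 p4 p0 s1 s2 s3 s4 s0 a12 a23 a34 h40 (fun v x y => tri _ _ _ y a01 x))
      have f2 := not_le.mp (finish p2 p3 p4 p0 p1 s2 s3 s4 s0 s1 a23 a34 h40 a01 (fun v x y => tri _ _ _ y a12 x))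
      have f3 := not_le.mp (finish p3 p4 p0 p1 p2 s3 s4 s0 s1 s2 a34 h40 a01 a12 (fun v x y => tri _ _ _ y a23 x))
      have f4 := not_le.mp (finish p4 p0 p1 p2 p3 s4 s0 s1 s2 s3 h40 a01 a12 a23 (fun v x y => tri _ _ _ y a34 x))
      omega
    · apply finish p0 p1 p2 p3 p4 s0 s1 s2 s3 s4 a01 a12 a23 a34 h04
      rw [Finset.filter_false_of_mem]
      · simp
      · intro v _ hv
        exact h03 v hv.1 hv.2

/-- twice the number of vertices needed -/
def N2 (a t : ℕ) : ℕ := if a = 0 then 1 else if a = 1 then 2 * t else (4 * a - 3) * t + 5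

theorem N2_split (a x y t : ℕ) (hx : 1 ≤ x) (hy : 1 ≤ y) (hxy : x + y = a) (ha : 3 ≤ a) :
    N2 x (t + 1) + N2 y (t + 1) + 2 * t ≤ N2 a (t + 1) + 2 := by
  subst hxy
  unfold N2
  rw [if_neg (by omega : ¬ x = 0), if_neg (by omega : ¬ y = 0), if_neg (by omega : ¬ x + y = 0),
    if_neg (by omega : ¬ x + y = 1)]
  by_cases h1 : x = 1
  · subst h1
    obtain ⟨z, rfl⟩ : ∃ z, y = z + 2 := ⟨y - 2, by omega⟩
    rw [if_pos rfl, if_neg (by omega), show 4 * (z + 2) - 3 = 4 * z + 5 by omega,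
      show 4 * (1 + (z + 2)) - 3 = 4 * z + 9 by omega]
    nlinarith
  · by_cases h2 : y = 1
    · subst h2
      obtain ⟨z, rfl⟩ : ∃ z, x = z + 2 := ⟨x - 2, by omega⟩
      rw [if_pos rfl, if_neg (by omega), show 4 * (z + 2) - 3 = 4 * z + 5 by omega,
        show 4 * (z + 2 + 1) - 3 = 4 * z + 9 by omega]
      nlinarith
    · obtain ⟨z, rfl⟩ : ∃ z, x = z + 2 := ⟨x - 2, by omega⟩
      obtain ⟨w, rfl⟩ : ∃ z, y = z + 2 := ⟨y - 2, by omega⟩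
      rw [if_neg h1, if_neg h2, show 4 * (z + 2) - 3 = 4 * z + 5 by omega,
        show 4 * (w + 2) - 3 = 4 * w + 5 by omega,
        show 4 * (z + 2 + (w + 2)) - 3 = 4 * z + 4 * w + 13 by omega]
      nlinarith

theorem N2_mono (a b t : ℕ) (hab : a ≤ b) : N2 a (t + 1) ≤ N2 b (t + 1) := by
  unfold N2
  split_ifs
  all_goals try omega
  · have := Nat.mul_le_mul_right (t + 1) (show 2 ≤ 4 * b - 3 by omega)
    omega
  · have := Nat.mul_le_mul_right (t + 1) (show 4 * a - 3 ≤ 4 * b - 3 by omega)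
    omega

open Classical in
theorem main_ind {V : Type*} (G : SimpleGraph V) : ∀ (a t : ℕ) (W : Finset V),
    (∀ I ⊆ W, (∀ x ∈ I, ∀ y ∈ I, ¬ G.Adj x y) → I.card ≤ a) → N2 a t ≤ 2 * W.card →
    ∃ M : Finset V, M.card = t ∧ SI G W M (2 * a - 1) := by
  intro a
  induction a using Nat.strong_induction_on with
  | _ a IH =>
  intro t
  induction t with
  | zero =>
    intro W _ _
    exact ⟨∅, by simp, by simp, id, by simp⟩
  | succ t ih =>
    intro W hW hcard
    rcases Nat.lt_or_ge a 3 with ha | ha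
    · have hcases : a = 0 ∨ a = 1 ∨ a = 2 := by omega
      rcases hcases with rfl | rfl | rfl
      · exfalso
        simp [N2] at hcard
        obtain ⟨x, hx⟩ := Finset.card_pos.mp (show 0 < W.card by omega)
        have := hW {x} (by simpa using hx) (by simp)
        simp at this
      · simp [N2] at hcard
        obtain ⟨M, hMC, hM⟩ := Finset.exists_subset_card_eq (show t + 1 ≤ W.card by omega)
        refine ⟨M, hM, SI.of_clique (by norm_num) hMC ?_⟩
        intro x hx y hy hxy
        by_contra hn
        have := hW {x, y} (by
          intro z hz
          simp at hz
          rcases hz with rfl | rfl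
          · exact hMC hx
          · exact hMC hy) (by
          intro z hz w hw
          simp at hz hw
          have hn2 : ¬ G.Adj y x := fun h => hn h.symm
          rcases hz with rfl | rfl <;> rcases hw with rfl | rfl <;> simp [hn, hn2])
        rw [Finset.card_pair hxy] at this
        omega
      · simp [N2] at hcard
        obtain ⟨M, hM, h⟩ := alpha_two G ((t + 2) / 2) W hW (by omega)
        obtain ⟨M', hMC, hM'⟩ := Finset.exists_subset_card_eq (show t + 1 ≤ M.card by omega)
        exact ⟨M', hM', h.mono (Finset.Subset.refl _) hMC (by norm_num)⟩
    · obtain ⟨I, hIW, hIind, hmax⟩ := exists_max_sub W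
        (fun I => ∀ x ∈ I, ∀ y ∈ I, ¬ G.Adj x y) (by simp)
      rcases Nat.lt_or_ge I.card a with hlt | hge
      · obtain ⟨M, hM, h⟩ := IH I.card hlt (t + 1) W hmax ((N2_mono _ _ t hlt.le).trans hcard)
        exact ⟨M, hM, h.mono (Finset.Subset.refl _) (Finset.Subset.refl _) (by omega)⟩
      have hIa : I.card = a := le_antisymm (hW I hIW hIind) hge
      by_contra hno
      have hWI : (W \ I).card = W.card - I.card := Finset.card_sdiff_of_subset hIW
      obtain ⟨M, hM, hSI⟩ := ih (W \ I) (fun J hJ h => hW J (hJ.trans Finset.sdiff_subset) h) (by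
        unfold N2 at hcard ⊢
        rw [if_neg (by omega), if_neg (by omega)] at hcard ⊢
        rw [hWI, hIa, Nat.mul_sub]
        have : (4 * a - 3) * (t + 1) = (4 * a - 3) * t + (4 * a - 3) := by ring
        omega)
      obtain ⟨s, hs⟩ := Finset.card_pos.mp (show 0 < I.card by omega)
      -- the sets seeing only `X`
      let O : Finset V → Finset V := fun X => W.filter (fun w => w ∈ X ∨ (w ∉ I ∧ I.filter (G.Adj w) ⊆ X))
      have hO : ∀ X ⊆ I, X.card < a → 2 * (O X).card < N2 X.card (t + 1) := by
        intro X hXI hXa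
        by_contra hcon
        obtain ⟨N, hN, hNS⟩ := IH X.card hXa (t + 1) (O X) (by
          intro J hJ hJi
          have hdis : Disjoint J (I \ X) := by
            rw [Finset.disjoint_left]
            intro v hv hv2
            have := Finset.mem_filter.mp (hJ hv)
            rw [Finset.mem_sdiff] at hv2
            rcases this.2 with h | h
            · exact hv2.2 h
            · exact h.1 hv2.1
          have hcross : ∀ v ∈ J, ∀ i ∈ I \ X, ¬ G.Adj v i := by
            intro v hv i hi hvi
            rw [Finset.mem_sdiff] at hi
            have := Finset.mem_filter.mp (hJ hv)
            rcases this.2 with h | h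
            · exact hIind v (hXI h) i hi.1 hvi
            · exact hi.2 (h.2 (Finset.mem_filter.mpr ⟨hi.1, hvi⟩))
          have := hmax (J ∪ (I \ X)) (Finset.union_subset (hJ.trans (Finset.filter_subset _ _))
            (Finset.sdiff_subset.trans hIW)) (by
            intro x hx y hy
            rw [Finset.mem_union] at hx hy
            rcases hx with hx | hx <;> rcases hy with hy | hy
            · exact hJi x hx y hy
            · exact hcross x hx y hy
            · exact fun h => hcross y hy x hx h.symm
            · exact hIind x (Finset.mem_sdiff.mp hx).1 y (Finset.mem_sdiff.mp hy).1)
          rw [Finset.card_union_of_disjoint hdis, Finset.card_sdiff_of_subset hXI] at this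
          have := Finset.card_le_card hXI
          omega) (by omega)
        exact hno ⟨N, hN, hNS.mono (Finset.filter_subset _ _) (Finset.Subset.refl _) (by omega)⟩
      have hsM : s ∉ M := fun h => (Finset.mem_sdiff.mp (hSI.1 h)).2 hs
      refine hno ⟨insert s M, by rw [Finset.card_insert_of_notMem hsM, hM], ?_⟩
      refine SI.step hIW hs (by omega) hSI ?_
      intro X hsX
      rcases (I ∩ X).eq_empty_or_nonempty with hemp | hne
      · -- no vertex has an empty neighbourhood in `I`
        have : M.filter (fun m => I.filter (G.Adj m) ⊆ X) = ∅ := by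
          rw [Finset.filter_eq_empty_iff]
          intro m hm hmX
          have hmI := Finset.mem_sdiff.mp (hSI.1 hm)
          have hnon : ∀ i ∈ I, ¬ G.Adj m i := by
            intro i hi hmi
            have h1 := hmX (Finset.mem_filter.mpr ⟨hi, hmi⟩)
            have h2 : i ∈ I ∩ X := Finset.mem_inter.mpr ⟨hi, h1⟩
            rw [hemp] at h2
            simp at h2
          have := hmax (insert m I) (Finset.insert_subset hmI.1 hIW) (by
            intro x hx y hy
            rw [Finset.mem_insert] at hx hy
            rcases hx with rfl | hx <;> rcases hy with rfl | hy
            · exact G.loopless.irrefl _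
            · exact hnon y hy
            · exact fun h => hnon x hx h.symm
            · exact hIind x hx y hy)
          rw [Finset.card_insert_of_notMem hmI.2] at this
          omega
        rw [this]
        simp
      · set X₁ := I ∩ X with hX₁
        set X₂ := I \ X₁ with hX₂
        have hX1I : X₁ ⊆ I := Finset.inter_subset_left
        have hc1 : 1 ≤ X₁.card := Finset.card_pos.mpr hne
        have hc2 : 1 ≤ X₂.card := Finset.card_pos.mpr ⟨s, by
          rw [hX₂, Finset.mem_sdiff, hX₁, Finset.mem_inter]
          exact ⟨hs, fun h => hsX h.2⟩⟩
        have hc12 : X₁.card + X₂.card = a := by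
          rw [hX₂, Finset.card_sdiff_of_subset hX1I]
          have := Finset.card_le_card hX1I
          omega
        have o1 := hO X₁ hX1I (by omega)
        have o2 := hO X₂ Finset.sdiff_subset (by omega)
        have hsp := N2_split a X₁.card X₂.card t hc1 hc2 hc12 ha
        let cr : V → Prop := fun u => (∃ i ∈ I.filter (G.Adj u), i ∈ X) ∧ ∃ i ∈ I.filter (G.Adj u), i ∉ X
        have hcov : W ⊆ O X₁ ∪ O X₂ ∪ (((W \ I) \ M).filter cr ∪ M.filter cr) := by
          intro w hw
          by_cases hwI : w ∈ I
          · apply Finset.mem_union_left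
            rw [Finset.mem_union]
            by_cases hwX : w ∈ X₁
            · exact Or.inl (Finset.mem_filter.mpr ⟨hw, Or.inl hwX⟩)
            · exact Or.inr (Finset.mem_filter.mpr ⟨hw, Or.inl (Finset.mem_sdiff.mpr ⟨hwI, hwX⟩)⟩)
          · by_cases hcr : cr w
            · apply Finset.mem_union_right
              rw [Finset.mem_union]
              by_cases hwM : w ∈ M
              · exact Or.inr (Finset.mem_filter.mpr ⟨hwM, hcr⟩)
              · exact Or.inl (Finset.mem_filter.mpr ⟨by simp [hw, hwI, hwM], hcr⟩)
            · apply Finset.mem_union_left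
              rw [Finset.mem_union]
              by_cases hx : ∃ i ∈ I.filter (G.Adj w), i ∈ X
              · left
                refine Finset.mem_filter.mpr ⟨hw, Or.inr ⟨hwI, fun i hi => ?_⟩⟩
                rw [hX₁, Finset.mem_inter]
                refine ⟨(Finset.mem_filter.mp hi).1, ?_⟩
                by_contra hiX
                exact hcr ⟨hx, i, hi, hiX⟩
              · right
                refine Finset.mem_filter.mpr ⟨hw, Or.inr ⟨hwI, fun i hi => ?_⟩⟩
                rw [hX₂, Finset.mem_sdiff, hX₁, Finset.mem_inter]
                exact ⟨(Finset.mem_filter.mp hi).1, fun h => hx ⟨i, hi, h.2⟩⟩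
        have k1 := Finset.card_le_card hcov
        have k2 := Finset.card_union_le (O X₁ ∪ O X₂) (((W \ I) \ M).filter cr ∪ M.filter cr)
        have k3 := Finset.card_union_le (O X₁) (O X₂)
        have k4 := Finset.card_union_le (((W \ I) \ M).filter cr) (M.filter cr)
        have k5 : (M.filter cr).card + (M.filter (fun m => I.filter (G.Adj m) ⊆ X)).card ≤ M.card := by
          rw [← Finset.card_union_of_disjoint]
          · exact Finset.card_le_card (Finset.union_subset (Finset.filter_subset _ _) (Finset.filter_subset _ _))
          · rw [Finset.disjoint_left]
            intro v hv hv2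
            obtain ⟨_, _, i, hi, hiX⟩ := Finset.mem_filter.mp hv
            exact hiX ((Finset.mem_filter.mp hv2).2 hi)
        change _ ≤ (((W \ I) \ M).filter cr).card
        omega

theorem fMain_bound (a : ℕ) (ha : 3 ≤ a) : 2 * (a : ℚ) - 3 / 2 ≤ 9 / 4 * (a : ℚ) - fMain a := by
  rcases Nat.lt_or_ge a 5 with h | h
  · have : a = 3 ∨ a = 4 := by omega
    rcases this with rfl | rfl <;> norm_num [fMain]
  · have key : ∀ b : ℕ, ∑ i ∈ Finset.Icc 6 (b + 6), 1 / (2 * (i : ℚ)) ≤ (b + 1) * (1 / 12) := by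
      intro b
      have : ∑ i ∈ Finset.Icc 6 (b + 6), 1 / (2 * (i : ℚ)) ≤ ∑ i ∈ Finset.Icc 6 (b + 6), (1 / 12 : ℚ) := by
        apply Finset.sum_le_sum
        intro i hi
        have h6 : (6 : ℚ) ≤ i := by exact_mod_cast (Finset.mem_Icc.mp hi).1
        apply one_div_le_one_div_of_le <;> linarith
      refine this.trans ?_
      rw [Finset.sum_const, Nat.card_Icc, nsmul_eq_mul]
      rw [show b + 6 + 1 - 6 = b + 1 by omega]
      push_cast
      exact le_refl _
    obtain ⟨b, rfl⟩ : ∃ b, a = b + 5 := ⟨a - 5, by omega⟩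
    have := key b
    unfold fMain
    rw [if_neg (by omega)]
    have hb : (0 : ℚ) ≤ b := by positivity
    rw [show b + 5 + 1 = b + 6 by omega]
    push_cast
    linarith

/-- Every `n`-vertex graph with independence number `α ≥ 3` contains a strong odd
`(2α - 1)`-immersion of a clique on at least `⌊n / (2.25 α - f α)⌋ - 1` vertices. -/
theorem strong_odd_clique_immersion_of_indepNum {V : Type*} [Fintype V]
    (G : SimpleGraph V) (n α : ℕ) (hn : Fintype.card V = n) (hα : 3 ≤ α)
    (hind : IndepNumEq G α) :
    ∃ k : ℕ, ⌊(n : ℚ) / ((9 / 4 : ℚ) * (α : ℚ) - fMain α)⌋ - 1 ≤ (k : ℤ) ∧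
      StrongOddBoundedCliqueImmersion G k (2 * α - 1) := by
  obtain ⟨-, hmax⟩ := hind
  have hb := fMain_bound α hα
  set c : ℚ := (9 / 4 : ℚ) * (α : ℚ) - fMain α with hc
  have hα' : (3 : ℚ) ≤ α := by exact_mod_cast hα
  have hcpos : 0 < c := by linarith
  set F : ℤ := ⌊(n : ℚ) / c⌋ with hF
  rcases le_or_gt (F - 1) 0 with hle | hgt
  · refine ⟨0, by simpa using hle, ?_⟩
    have : SI G (∅ : Finset V) ∅ (2 * α - 1) := ⟨by simp, id, by simp⟩
    exact this.final
  · obtain ⟨k, hk⟩ := Int.eq_ofNat_of_zero_le hgt.le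
    refine ⟨k, hk.le, ?_⟩
    have hfl : (F : ℚ) ≤ (n : ℚ) / c := Int.floor_le _
    rw [le_div_iff₀ hcpos] at hfl
    have hFk : (F : ℚ) = k + 1 := by
      have : F = (k : ℤ) + 1 := by omega
      rw [this]
      push_cast
      rfl
    rw [hFk] at hfl
    have hn2 : N2 α k ≤ 2 * (Finset.univ : Finset V).card := by
      rw [Finset.card_univ, hn]
      unfold N2
      rw [if_neg (by omega), if_neg (by omega)]
      have h3 : ((4 * α - 3 : ℕ) : ℚ) = 4 * (α : ℚ) - 3 := by
        rw [Nat.cast_sub (by omega)]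
        push_cast
        rfl
      have : (((4 * α - 3) * k + 5 : ℕ) : ℚ) ≤ ((2 * n : ℕ) : ℚ) := by
        rw [Nat.cast_add, Nat.cast_mul, h3]
        push_cast
        have hk0 : (0 : ℚ) ≤ k := by positivity
        nlinarith [mul_le_mul_of_nonneg_left hb hk0]
      exact_mod_cast this
    obtain ⟨M, hM, hSI⟩ := main_ind G α k Finset.univ (by
      intro I _ hI
      exact hmax I (fun x hx y hy _ => hI x hx y hy)) hn2
    rw [← hM]
    exact hSI.final
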